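/- arXiv:2402.06618 — 2 statements merged into one kernel-verified Lean document; each statement's English description precedes it below -/
import Mathlib

section
/- For every n ≥ 0, κ_n is a rational number, and there exists a (unique) polynomial P_n with rational coefficients whose evaluation at every x ∈ [0,1] equals q_n(x). -/
open Set MeasureTheory Polynomial

noncomputable section

/-- The class `E` of antitone functions `g : [0,1] → [0,1]` with `g 0 = 1` and
positive integral (functions are modelled as total functions `ℝ → ℝ`,
constrained on `[0,1]`). -/
def E : Set (ℝ → ℝ) :=
  {g | AntitoneOn g (Icc 0 1) ∧ MapsTo g (Icc 0 1) (Icc 0 1) ∧ g 0 = 1 ∧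
    0 < ∫ x in (0:ℝ)..1, g x}

/-- The pseudo-inverse `g*` of `g`, given by `g* y = sup {x ∈ [0,1] | g x ≥ y}`. -/
def pseudoInv (g : ℝ → ℝ) : ℝ → ℝ := fun y => sSup {x | x ∈ Icc (0:ℝ) 1 ∧ y ≤ g x}

/-- The stribolic operator `T`, `(T g) x = (∫_x^1 g*) / (∫_0^1 g)`. -/
def T (g : ℝ → ℝ) : ℝ → ℝ := fun x =>
  (∫ t in x..(1:ℝ), pseudoInv g t) / (∫ t in (0:ℝ)..1, g t)

/-- The canonical stribolic iterates: `h 0 = 1` and `h (n+1) = T (h n)`. -/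
def h : ℕ → ℝ → ℝ
  | 0 => fun _ => 1
  | n + 1 => T (h n)

/-- `κ n = ∫_0^1 h n`. -/
def κ (n : ℕ) : ℝ := ∫ t in (0:ℝ)..1, h n t

/-- The compositions `q n = h n ∘ ⋯ ∘ h 1`, with `q 0 = id`. -/
def q : ℕ → ℝ → ℝ
  | 0 => fun x => x
  | n + 1 => h (n + 1) ∘ q n

/-- `q (n-1)`, with the convention that for `n = 0` (i.e. "`q (-1)`") it is the
constant function `1` (the only convention making the `n = 0` cases hold). -/
def qprev : ℕ → ℝ → ℝ
  | 0 => fun _ => 1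
  | n + 1 => q n

/-- `Q n x = ∫_0^x (q n)' (t) * q (n-1) (t) dt`. -/
def Q (n : ℕ) (x : ℝ) : ℝ := ∫ t in (0:ℝ)..x, deriv (q n) t * qprev n t

/-- Strictly decreasing bijections of the unit interval with a derivative on the interior that
extends continuously to the endpoints. -/
structure IsDecreasingC1 (g : ℝ → ℝ) : Prop where
  continuousOn : ContinuousOn g (Icc 0 1)
  strictAntiOn : StrictAntiOn g (Icc 0 1)
  map_zero : g 0 = 1
  map_one : g 1 = 0
  exists_deriv : ∃ g' : ℝ → ℝ, ContinuousOn g' (Icc 0 1) ∧ ∀ x ∈ Ioo (0:ℝ) 1, HasDerivAt g (g' x) x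

lemma zero_mem_Icc : (0:ℝ) ∈ Icc (0:ℝ) 1 := by simp

lemma one_mem_Icc : (1:ℝ) ∈ Icc (0:ℝ) 1 := by simp

lemma uIcc_subset_unit {a b : ℝ} (ha : a ∈ Icc (0:ℝ) 1) (hb : b ∈ Icc (0:ℝ) 1) :
    uIcc a b ⊆ Icc 0 1 :=
  ordConnected_Icc.uIcc_subset ha hb

namespace IsDecreasingC1

variable {g : ℝ → ℝ}

lemma mapsTo (hg : IsDecreasingC1 g) : MapsTo g (Icc 0 1) (Icc 0 1) := by
  intro x hx
  constructor
  · rw [← hg.map_one]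
    exact hg.strictAntiOn.antitoneOn hx one_mem_Icc hx.2
  · rw [← hg.map_zero]
    exact hg.strictAntiOn.antitoneOn zero_mem_Icc hx hx.1

lemma surjOn (hg : IsDecreasingC1 g) : SurjOn g (Icc 0 1) (Icc 0 1) := by
  have := intermediate_value_Icc' (zero_le_one' ℝ) hg.continuousOn
  rwa [hg.map_one, hg.map_zero] at this

lemma pseudoInv_apply (hg : IsDecreasingC1 g) {x : ℝ} (hx : x ∈ Icc (0:ℝ) 1) :
    pseudoInv g (g x) = x := by
  have : {z | z ∈ Icc (0:ℝ) 1 ∧ g x ≤ g z} = Icc 0 x := by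
    ext z
    constructor
    · rintro ⟨hz, h⟩
      exact ⟨hz.1, (hg.strictAntiOn.le_iff_ge hx hz).1 h⟩
    · intro hz
      have hz' : z ∈ Icc (0:ℝ) 1 := ⟨hz.1, hz.2.trans hx.2⟩
      exact ⟨hz', (hg.strictAntiOn.le_iff_ge hx hz').2 hz.2⟩
  rw [pseudoInv, this, csSup_Icc hx.1]

lemma continuousOn_pseudoInv (hg : IsDecreasingC1 g) :
    ContinuousOn (pseudoInv g) (Icc 0 1) := by
  rw [continuousOn_iff_isClosed]
  intro t ht
  refine ⟨g '' (t ∩ Icc 0 1), ?_, ?_⟩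
  · exact ((isCompact_Icc.inter_left ht).image_of_continuousOn
      (hg.continuousOn.mono inter_subset_right)).isClosed
  · ext y
    constructor
    · rintro ⟨hyt, hy⟩
      obtain ⟨x, hx, rfl⟩ := hg.surjOn hy
      rw [mem_preimage, hg.pseudoInv_apply hx] at hyt
      exact ⟨⟨x, ⟨hyt, hx⟩, rfl⟩, hy⟩
    · rintro ⟨⟨x, ⟨hxt, hx⟩, rfl⟩, hy⟩
      refine ⟨?_, hy⟩
      rwa [mem_preimage, hg.pseudoInv_apply hx]

lemma pseudoInv_pos (hg : IsDecreasingC1 g) {y : ℝ} (hy : y ∈ Ioo (0:ℝ) 1) :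
    0 < pseudoInv g y := by
  obtain ⟨x, hx, rfl⟩ := hg.surjOn (Ioo_subset_Icc_self hy)
  rw [hg.pseudoInv_apply hx]
  refine hx.1.lt_of_ne ?_
  rintro rfl
  exact hy.2.ne hg.map_zero

/-- Equality in Young's inequality for the pair `g`, `pseudoInv g`. -/
lemma integral_pseudoInv (hg : IsDecreasingC1 g) {x : ℝ} (hx : x ∈ Icc (0:ℝ) 1) :
    ∫ t in g x..1, pseudoInv g t = (∫ t in (0:ℝ)..x, g t) - x * g x := by
  obtain ⟨g', hg'c, hg'⟩ := hg.exists_deriv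
  have hsub : uIcc x 0 ⊆ Icc 0 1 := uIcc_subset_unit hx zero_mem_Icc
  have hderiv : ∀ s ∈ Ioo (min x 0) (max x 0), HasDerivAt g (g' s) s := by
    intro s hs
    rw [min_eq_right hx.1, max_eq_left hx.1] at hs
    exact hg' s ⟨hs.1, hs.2.trans_le hx.2⟩
  have himage : g '' uIcc x 0 ⊆ Icc 0 1 := (image_mono hsub).trans hg.mapsTo.image_subset
  have hsubst := intervalIntegral.integral_comp_mul_deriv'' (hg.continuousOn.mono hsub)
    (fun s hs => (hderiv s hs).hasDerivWithinAt) (hg'c.mono hsub)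
    (hg.continuousOn_pseudoInv.mono himage)
  have hparts := intervalIntegral.integral_mul_deriv_eq_deriv_mul_of_hasDerivAt
    (u := fun s : ℝ => s) (u' := fun _ => 1) continuousOn_id (hg.continuousOn.mono hsub)
    (fun s _ => hasDerivAt_id s) hderiv intervalIntegrable_const
    (hg'c.mono hsub).intervalIntegrable
  rw [hg.map_zero] at hsubst
  rw [← hsubst, intervalIntegral.integral_congr (g := fun s => s * g' s), hparts,
    intervalIntegral.integral_symm 0 x]
  · simp only [one_mul]
    ring
  · intro s hs
    simp [hg.pseudoInv_apply (hsub hs)]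

lemma integral_pos (hg : IsDecreasingC1 g) : 0 < ∫ t in (0:ℝ)..1, g t := by
  refine intervalIntegral.intervalIntegral_pos_of_pos_on ?_ (fun x hx => ?_) one_pos
  · exact (hg.continuousOn.mono (uIcc_subset_unit zero_mem_Icc one_mem_Icc)).intervalIntegrable
  · rw [← hg.map_one]
    exact hg.strictAntiOn (Ioo_subset_Icc_self hx) one_mem_Icc hx.2

lemma T_comp_self (hg : IsDecreasingC1 g) {x : ℝ} (hx : x ∈ Icc (0:ℝ) 1) :
    T g (g x) = ((∫ t in (0:ℝ)..x, g t) - x * g x) / ∫ t in (0:ℝ)..1, g t := by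
  rw [T, hg.integral_pseudoInv hx]

end IsDecreasingC1

lemma isDecreasingC1_T_of_pseudoInv {g : ℝ → ℝ} (hc : ContinuousOn (pseudoInv g) (Icc 0 1))
    (hpos : ∀ y ∈ Ioo (0:ℝ) 1, 0 < pseudoInv g y)
    (hint : ∫ t in (0:ℝ)..1, pseudoInv g t = ∫ t in (0:ℝ)..1, g t) :
    IsDecreasingC1 (T g) := by
  have hintegrable {a : ℝ} (ha : a ∈ Icc (0:ℝ) 1) :
      IntervalIntegrable (pseudoInv g) volume a 1 :=
    (hc.mono (uIcc_subset_unit ha one_mem_Icc)).intervalIntegrable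
  have hκ : 0 < ∫ t in (0:ℝ)..1, g t := by
    rw [← hint]
    exact intervalIntegral.intervalIntegral_pos_of_pos_on (hintegrable zero_mem_Icc) hpos one_pos
  have hderiv : ∀ x ∈ Ioo (0:ℝ) 1,
      HasDerivAt (T g) (-pseudoInv g x / ∫ t in (0:ℝ)..1, g t) x := by
    intro x hx
    exact (intervalIntegral.integral_hasDerivAt_left (hintegrable (Ioo_subset_Icc_self hx))
      ((hc.mono Ioo_subset_Icc_self).stronglyMeasurableAtFilter isOpen_Ioo x hx)
      (hc.continuousAt (Icc_mem_nhds hx.1 hx.2))).div_const _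
  have hcont : ContinuousOn (T g) (Icc 0 1) := by
    have := intervalIntegral.continuousOn_primitive_interval_left (μ := volume)
      (f := pseudoInv g) (a := 0) (b := 1)
      (by rw [uIcc_of_le zero_le_one]; exact hc.integrableOn_Icc)
    rw [uIcc_of_le zero_le_one] at this
    exact this.div_const _
  refine ⟨hcont, ?_, ?_, by simp [T], _, hc.neg.div_const _, hderiv⟩
  · refine strictAntiOn_of_deriv_neg (convex_Icc 0 1) hcont fun x hx => ?_
    rw [interior_Icc] at hx
    rw [(hderiv x hx).deriv]
    exact div_neg_of_neg_of_pos (neg_neg_of_pos (hpos x hx)) hκ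
  · rw [T, hint, div_self hκ.ne']

lemma IsDecreasingC1.map_T {g : ℝ → ℝ} (hg : IsDecreasingC1 g) : IsDecreasingC1 (T g) := by
  refine isDecreasingC1_T_of_pseudoInv hg.continuousOn_pseudoInv (fun _ hy => hg.pseudoInv_pos hy) ?_
  simpa [hg.map_one] using hg.integral_pseudoInv one_mem_Icc

lemma pseudoInv_one {y : ℝ} (hy : y ≤ 1) : pseudoInv (fun _ => 1) y = 1 := by
  simp only [pseudoInv, hy, and_true]
  exact csSup_Icc zero_le_one

lemma isDecreasingC1_h (n : ℕ) : IsDecreasingC1 (h (n + 1)) := by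
  induction n with
  | zero =>
    refine isDecreasingC1_T_of_pseudoInv (g := fun _ => 1) ?_ ?_ ?_
    · exact continuousOn_const.congr fun y hy => pseudoInv_one hy.2
    · intro y hy
      rw [pseudoInv_one hy.2.le]
      exact one_pos
    · refine intervalIntegral.integral_congr fun y hy => ?_
      rw [uIcc_of_le zero_le_one] at hy
      exact pseudoInv_one hy.2
  | succ n ih => exact ih.map_T

lemma h_one {x : ℝ} (hx : x ∈ Icc (0:ℝ) 1) : h 1 x = 1 - x := by
  have : ∫ t in x..(1:ℝ), pseudoInv (fun _ => 1) t = ∫ _ in x..(1:ℝ), (1:ℝ) :=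
    intervalIntegral.integral_congr fun y hy =>
      pseudoInv_one (uIcc_subset_unit hx one_mem_Icc hy).2
  simp [h, T, this]

lemma q_mapsTo (n : ℕ) : MapsTo (q n) (Icc 0 1) (Icc 0 1) := by
  induction n with
  | zero => exact mapsTo_id _
  | succ n ih => exact (isDecreasingC1_h n).mapsTo.comp ih

/-- The endpoints of the unit interval are either fixed or exchanged by `q n`. -/
lemma q_endpoints (n : ℕ) : (q n 0 = 0 ∧ q n 1 = 1) ∨ (q n 0 = 1 ∧ q n 1 = 0) := by
  induction n with
  | zero => simp [q]
  | succ n ih =>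
    have hn := isDecreasingC1_h n
    rcases ih with ⟨h0, h1⟩ | ⟨h0, h1⟩ <;> simp [q, h0, h1, hn.map_zero, hn.map_one]

lemma exists_rat_preimage_endpoints (n : ℕ) :
    ∃ a b : ℚ, (a : ℝ) ∈ Icc (0:ℝ) 1 ∧ (b : ℝ) ∈ Icc (0:ℝ) 1 ∧ q n a = 0 ∧ q n b = 1 := by
  rcases q_endpoints n with ⟨h0, h1⟩ | ⟨h0, h1⟩
  · exact ⟨0, 1, by simp, by simp, by simpa using h0, by simpa using h1⟩
  · exact ⟨1, 0, by simp, by simp, by simpa using h1, by simpa using h0⟩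

lemma q_add_two (n : ℕ) {x : ℝ} (hx : x ∈ Icc (0:ℝ) 1) :
    q (n + 2) x = ((∫ t in (0:ℝ)..q n x, h (n + 1) t) - q n x * q (n + 1) x) / κ (n + 1) :=
  (isDecreasingC1_h n).T_comp_self (q_mapsTo n hx)

lemma exists_derivative_eq {K : Type*} [Field K] [CharZero K] (p : K[X]) :
    ∃ r : K[X], derivative r = p := by
  induction p using Polynomial.induction_on' with
  | add p₁ p₂ h₁ h₂ =>
    obtain ⟨r₁, rfl⟩ := h₁
    obtain ⟨r₂, rfl⟩ := h₂
    exact ⟨r₁ + r₂, derivative_add⟩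
  | monomial n a =>
    refine ⟨monomial (n + 1) (a / (n + 1)), ?_⟩
    have : (n : K) + 1 ≠ 0 := by exact_mod_cast n.succ_ne_zero
    rw [derivative_monomial]
    simp [div_mul_cancel₀ _ this]

lemma exists_polynomial_integral_h {n : ℕ} {P₀ P₁ : ℚ[X]}
    (h₀ : ∀ x ∈ Icc (0:ℝ) 1, q n x = aeval x P₀)
    (h₁ : ∀ x ∈ Icc (0:ℝ) 1, q (n + 1) x = aeval x P₁) :
    ∃ R : ℚ[X], ∀ x ∈ Icc (0:ℝ) 1, ∫ t in (0:ℝ)..q n x, h (n + 1) t = aeval x R := by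
  obtain ⟨R, hR⟩ := exists_derivative_eq (P₁ * derivative P₀)
  obtain ⟨a, -, ha, -, hqa, -⟩ := exists_rat_preimage_endpoints n
  refine ⟨R - C (R.eval a), fun x hx => ?_⟩
  have hsub := uIcc_subset_unit ha hx
  have himage : (fun s : ℝ => aeval s P₀) '' uIcc (a : ℝ) x ⊆ Icc 0 1 := by
    rintro _ ⟨s, hs, rfl⟩
    simpa only [← h₀ s (hsub hs)] using q_mapsTo n (hsub hs)
  have hsubst := intervalIntegral.integral_comp_mul_deriv'' (a := (a : ℝ)) (b := x)
    (f := fun s => aeval s P₀) (f' := fun s => aeval s (derivative P₀)) (g := h (n + 1))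
    P₀.continuous_aeval.continuousOn
    (fun s _ => (P₀.hasDerivAt_aeval s).hasDerivWithinAt)
    (derivative P₀).continuous_aeval.continuousOn
    ((isDecreasingC1_h n).continuousOn.mono himage)
  have hFTC := intervalIntegral.integral_eq_sub_of_hasDerivAt (a := (a : ℝ)) (b := x)
    (fun s _ => R.hasDerivAt_aeval s)
    (derivative R).continuous_aeval.continuousOn.intervalIntegrable
  rw [← h₀ x hx, ← h₀ a ha, hqa] at hsubst
  rw [← hsubst, intervalIntegral.integral_congr (g := fun s => aeval s (derivative R)), hFTC]
  · have : aeval (a : ℝ) R = ((R.eval a : ℚ) : ℝ) := by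
      simpa using aeval_algebraMap_apply_eq_algebraMap_eval (A := ℝ) a R
    simp [this]
  · intro s hs
    simp only [Function.comp_apply, hR, map_mul, ← h₁ s (hsub hs), ← h₀ s (hsub hs)]
    rfl

lemma exists_rat_κ_succ {n : ℕ} {P₀ P₁ : ℚ[X]}
    (h₀ : ∀ x ∈ Icc (0:ℝ) 1, q n x = aeval x P₀)
    (h₁ : ∀ x ∈ Icc (0:ℝ) 1, q (n + 1) x = aeval x P₁) :
    ∃ r : ℚ, κ (n + 1) = (r : ℝ) := by
  obtain ⟨R, hR⟩ := exists_polynomial_integral_h h₀ h₁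
  obtain ⟨-, b, -, hb, -, hqb⟩ := exists_rat_preimage_endpoints n
  refine ⟨R.eval b, ?_⟩
  rw [κ, ← hqb, hR b hb]
  simpa using aeval_algebraMap_apply_eq_algebraMap_eval (A := ℝ) b R

lemma exists_polynomial_q (n : ℕ) : ∃ P : ℚ[X], ∀ x ∈ Icc (0:ℝ) 1, q n x = aeval x P := by
  induction n using Nat.twoStepInduction with
  | zero => exact ⟨X, by simp [q]⟩
  | one =>
    refine ⟨1 - X, fun x hx => ?_⟩
    simpa [q] using h_one hx
  | more n ih₀ ih₁ =>
    obtain ⟨P₀, h₀⟩ := ih₀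
    obtain ⟨P₁, h₁⟩ := ih₁
    obtain ⟨R, hR⟩ := exists_polynomial_integral_h h₀ h₁
    obtain ⟨r, hr⟩ := exists_rat_κ_succ h₀ h₁
    refine ⟨C r⁻¹ * (R - P₀ * P₁), fun x hx => ?_⟩
    rw [q_add_two n hx, hr, hR x hx, h₀ x hx, h₁ x hx]
    simp [div_eq_inv_mul]

lemma eq_of_aeval_eqOn_Icc {P P' : ℚ[X]}
    (hP : ∀ x ∈ Icc (0:ℝ) 1, aeval x P = aeval x P') : P = P' := by
  apply map_injective (algebraMap ℚ ℝ) (algebraMap ℚ ℝ).injective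
  refine eq_of_infinite_eval_eq _ _ ((Icc_infinite zero_lt_one).mono fun x hx => ?_)
  simpa only [mem_ofPred_eq, eval_map_algebraMap] using hP x hx

/-- For every n ≥ 0, κ n is rational, and there is a unique rational polynomial
whose evaluation at each x ∈ [0,1] equals q n x. -/
theorem stmt3 : ∀ n : ℕ,
    (∃ r : ℚ, κ n = (r : ℝ)) ∧
    (∃! P : Polynomial ℚ, ∀ x ∈ Icc (0:ℝ) 1, q n x = aeval x P) := by
  intro n
  constructor
  · cases n with
    | zero => exact ⟨1, by simp [κ, h]⟩
    | succ n =>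
      obtain ⟨P₀, h₀⟩ := exists_polynomial_q n
      obtain ⟨P₁, h₁⟩ := exists_polynomial_q (n + 1)
      exact exists_rat_κ_succ h₀ h₁
  · obtain ⟨P, hP⟩ := exists_polynomial_q n
    exact ⟨P, hP, fun P' hP' => eq_of_aeval_eqOn_Icc fun x hx => (hP' x hx).symm.trans (hP x hx)⟩
end
end

section
/- For every n ≥ 1, κ_n − 1 + κ_n/κ_{n-1} < κ, where κ := inf_{n≥0} κ_n. -/
open Set MeasureTheory Polynomial

noncomputable section

/-- Continuous functions on `ℝ` that decrease strictly from `1` to `0` on `[0,1]` and vanish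
on `[1,∞)`. -/
structure Good (g : ℝ → ℝ) : Prop where
  cont : Continuous g
  anti : StrictAntiOn g (Icc 0 1)
  zero : g 0 = 1
  one : ∀ x, 1 ≤ x → g x = 0

lemma pseudoInv_bddAbove (g : ℝ → ℝ) (y : ℝ) : BddAbove {x | x ∈ Icc (0:ℝ) 1 ∧ y ≤ g x} :=
  ⟨1, fun _ hx => hx.1.2⟩

lemma pseudoInv_nonneg (g : ℝ → ℝ) (y : ℝ) : 0 ≤ pseudoInv g y :=
  Real.sSup_nonneg fun _ hx => hx.1.1

lemma pseudoInv_le_one (g : ℝ → ℝ) (y : ℝ) : pseudoInv g y ≤ 1 :=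
  Real.sSup_le (fun _ hx => hx.1.2) zero_le_one

lemma pseudoInv_antitone (g : ℝ → ℝ) : Antitone (pseudoInv g) := fun _ _ hyz =>
  Real.sSup_le (fun _ hx => le_csSup (pseudoInv_bddAbove g _) ⟨hx.1, hyz.trans hx.2⟩)
    (pseudoInv_nonneg g _)

lemma pseudoInv_intervalIntegrable (g : ℝ → ℝ) (a b : ℝ) :
    IntervalIntegrable (pseudoInv g) volume a b :=
  (pseudoInv_antitone g).intervalIntegrable

namespace Good

variable {g : ℝ → ℝ}

lemma antitoneOn_Ici (hg : Good g) : AntitoneOn g (Ici 0) := by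
  intro a ha b hb hab
  rcases le_or_gt b 1 with h1 | h1
  · exact hg.anti.antitoneOn ⟨ha, hab.trans h1⟩ ⟨hb, h1⟩ hab
  · rw [hg.one b h1.le]
    rcases le_or_gt a 1 with h2 | h2
    · rw [← hg.one 1 le_rfl]
      exact hg.anti.antitoneOn ⟨ha, h2⟩ ⟨zero_le_one, le_rfl⟩ h2
    · rw [hg.one a h2.le]

lemma nonneg (hg : Good g) {x : ℝ} (hx : 0 ≤ x) : 0 ≤ g x := by
  have := hg.antitoneOn_Ici hx (b := max x 1) (hx.trans (le_max_left _ _)) (le_max_left _ _)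
  rwa [hg.one _ (le_max_right _ _)] at this

lemma le_one (hg : Good g) {x : ℝ} (hx : 0 ≤ x) : g x ≤ 1 := by
  have := hg.antitoneOn_Ici (self_mem_Ici) hx hx
  rwa [hg.zero] at this

lemma pos (hg : Good g) {x : ℝ} (hx : 0 ≤ x) (hx1 : x < 1) : 0 < g x := by
  have := hg.anti ⟨hx, hx1.le⟩ ⟨zero_le_one, le_rfl⟩ hx1
  rwa [hg.one 1 le_rfl] at this

lemma lt_pseudoInv_iff (hg : Good g) {a y : ℝ} (h0 : 0 ≤ a) (h1 : a < 1) :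
    a < pseudoInv g y ↔ y < g a := by
  constructor
  · intro h
    by_contra! hy
    refine absurd h (not_lt.2 (Real.sSup_le (fun x hx => ?_) h0))
    by_contra! hax
    exact absurd (hg.anti ⟨h0, h1.le⟩ hx.1 hax) (not_lt.2 (hy.trans hx.2))
  · intro h
    have hev : ∀ᶠ b in nhdsWithin a (Ioi a), y < g b :=
      (hg.cont.continuousAt.eventually (lt_mem_nhds h)).filter_mono nhdsWithin_le_nhds
    obtain ⟨b, hb, hab⟩ := (hev.and (Ioo_mem_nhdsGT h1)).exists
    exact hab.1.trans_le
      (le_csSup (pseudoInv_bddAbove g y) ⟨⟨h0.trans hab.1.le, hab.2.le⟩, hb.le⟩)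

lemma pseudoInv_lt_iff (hg : Good g) {a y : ℝ} (h0 : 0 < a) (h1 : a ≤ 1) :
    pseudoInv g y < a ↔ g a < y := by
  constructor
  · intro h
    by_contra! hy
    exact absurd h (not_lt.2 (le_csSup (pseudoInv_bddAbove g y) ⟨⟨h0.le, h1⟩, hy⟩))
  · intro h
    have hev : ∀ᶠ b in nhdsWithin a (Iio a), g b < y :=
      (hg.cont.continuousAt.eventually (gt_mem_nhds h)).filter_mono nhdsWithin_le_nhds
    obtain ⟨b, hb, hab⟩ := (hev.and (Ioo_mem_nhdsLT h0)).exists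
    refine lt_of_le_of_lt ?_ hab.2
    by_contra! hlt
    exact absurd ((hg.lt_pseudoInv_iff hab.1.le (hab.2.trans_le h1)).1 hlt) (not_lt.2 hb.le)

lemma pseudoInv_pos (hg : Good g) {y : ℝ} (hy : y < 1) : 0 < pseudoInv g y := by
  rw [hg.lt_pseudoInv_iff le_rfl zero_lt_one, hg.zero]; exact hy

lemma pseudoInv_lt_one (hg : Good g) {y : ℝ} (hy : 0 < y) : pseudoInv g y < 1 := by
  rw [hg.pseudoInv_lt_iff zero_lt_one le_rfl, hg.one 1 le_rfl]; exact hy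

lemma apply_pseudoInv (hg : Good g) {y : ℝ} (h0 : 0 < y) (h1 : y < 1) :
    g (pseudoInv g y) = y := by
  have ha := hg.pseudoInv_pos h1
  have hb := hg.pseudoInv_lt_one h0
  refine le_antisymm ?_ ?_
  · by_contra! h
    exact lt_irrefl _ ((hg.lt_pseudoInv_iff ha.le hb).2 h)
  · by_contra! h
    exact lt_irrefl _ ((hg.pseudoInv_lt_iff ha hb.le).2 h)

lemma pseudoInv_strictAnti (hg : Good g) {y z : ℝ} (hy : 0 < y) (hyz : y < z) (hz : z < 1) :
    pseudoInv g z < pseudoInv g y := by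
  rw [hg.pseudoInv_lt_iff (hg.pseudoInv_pos (hyz.trans hz)) (pseudoInv_le_one _ _),
    hg.apply_pseudoInv hy (hyz.trans hz)]
  exact hyz

lemma pseudoInv_zero (hg : Good g) : pseudoInv g 0 = 1 := by
  refine le_antisymm (pseudoInv_le_one g 0) ?_
  exact le_csSup (pseudoInv_bddAbove g 0) ⟨⟨zero_le_one, le_rfl⟩, (hg.one 1 le_rfl).ge⟩

lemma pseudoInv_eq_zero (hg : Good g) {y : ℝ} (hy : 1 ≤ y) : pseudoInv g y = 0 := by
  refine le_antisymm ?_ (pseudoInv_nonneg g y)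
  by_contra! h
  rw [hg.lt_pseudoInv_iff le_rfl zero_lt_one, hg.zero] at h
  linarith

lemma continuous_pseudoInv (hg : Good g) : Continuous (pseudoInv g) := by
  rw [continuous_iff_lower_upperSemicontinuous]
  constructor
  · intro y a hay
    rcases lt_or_ge a 0 with h0 | h0
    · exact Filter.Eventually.of_forall fun z => h0.trans_le (pseudoInv_nonneg g z)
    · have h1 := hay.trans_le (pseudoInv_le_one g y)
      have hay := (hg.lt_pseudoInv_iff h0 h1).1 hay
      filter_upwards [gt_mem_nhds hay] with z hz
      exact (hg.lt_pseudoInv_iff h0 h1).2 hz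
  · intro y a hay
    rcases lt_or_ge 1 a with h1 | h1
    · exact Filter.Eventually.of_forall fun z => (pseudoInv_le_one g z).trans_lt h1
    · have h0 := (pseudoInv_nonneg g y).trans_lt hay
      have hay := (hg.pseudoInv_lt_iff h0 h1).1 hay
      filter_upwards [lt_mem_nhds hay] with z hz
      exact (hg.pseudoInv_lt_iff h0 h1).2 hz

lemma integral_pos (hg : Good g) : 0 < ∫ t in (0:ℝ)..1, g t :=
  intervalIntegral.intervalIntegral_pos_of_pos_on (hg.cont.intervalIntegrable _ _)
    (fun _ hx => hg.pos hx.1.le hx.2) zero_lt_one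

lemma integral_pseudoInv (hg : Good g) :
    ∫ t in (0:ℝ)..1, pseudoInv g t = ∫ t in (0:ℝ)..1, g t := by
  rw [intervalIntegral.integral_of_le zero_le_one, intervalIntegral.integral_of_le zero_le_one]
  have hint : Integrable g (volume.restrict (Ioc 0 1)) :=
    (hg.cont.intervalIntegrable 0 1).1
  have hnn : 0 ≤ᵐ[volume.restrict (Ioc 0 1)] g := by
    filter_upwards [ae_restrict_mem measurableSet_Ioc] with x hx
    exact hg.nonneg hx.1.le
  rw [hint.integral_eq_integral_meas_lt hnn]
  have key : ∀ t ∈ Ioi (0:ℝ), (volume.restrict (Ioc (0:ℝ) 1)).real {a | t < g a}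
      = pseudoInv g t := by
    intro t ht
    have hset : {a | t < g a} ∩ Ioc 0 1 = Ioo 0 (pseudoInv g t) := by
      ext a
      simp only [mem_inter_iff, mem_ofPred_eq, mem_Ioc, mem_Ioo]
      constructor
      · rintro ⟨h1, h2, h3⟩
        have : a < 1 := by
          refine lt_of_le_of_ne h3 ?_
          rintro rfl
          rw [hg.one 1 le_rfl] at h1
          exact lt_asymm h1 ht
        exact ⟨h2, (hg.lt_pseudoInv_iff h2.le this).2 h1⟩
      · rintro ⟨h1, h2⟩
        have : a < 1 := h2.trans_le (pseudoInv_le_one _ _)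
        exact ⟨(hg.lt_pseudoInv_iff h1.le this).1 h2, h1, this.le⟩
    rw [measureReal_restrict_apply' measurableSet_Ioc, hset, Real.volume_real_Ioo]
    simp [pseudoInv_nonneg]
  rw [setIntegral_congr_fun measurableSet_Ioi key]
  refine (setIntegral_eq_of_subset_of_forall_sdiff_eq_zero measurableSet_Ioi
    (fun x hx => hx.1) ?_).symm
  rintro x ⟨hx0, hx1⟩
  refine hg.pseudoInv_eq_zero ?_
  by_contra! h
  exact hx1 ⟨hx0, h.le⟩

lemma T_zero (hg : Good g) : T g 0 = 1 := by
  rw [T, hg.integral_pseudoInv]; exact div_self hg.integral_pos.ne'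

end Good

lemma T_sub (g : ℝ → ℝ) (x y : ℝ) :
    T g y - T g x = -((∫ t in x..y, pseudoInv g t) / ∫ t in (0:ℝ)..1, g t) := by
  rw [T, T, ← intervalIntegral.integral_add_adjacent_intervals
    (pseudoInv_intervalIntegrable g x y) (pseudoInv_intervalIntegrable g y 1)]
  ring

lemma Good.map_T {g : ℝ → ℝ} (hg : Good g) : Good (T g) where
  cont := by
    have : T g = fun x => -(∫ t in (1:ℝ)..x, pseudoInv g t) / (∫ t in (0:ℝ)..1, g t) := by
      ext x; rw [T, intervalIntegral.integral_symm]
    rw [this]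
    exact ((intervalIntegral.continuous_primitive
      (fun a b => pseudoInv_intervalIntegrable g a b) 1).neg).div_const _
  anti := by
    intro x hx y hy hxy
    have h1 := T_sub g x y
    have h2 : 0 < ∫ t in x..y, pseudoInv g t :=
      intervalIntegral.intervalIntegral_pos_of_pos_on (pseudoInv_intervalIntegrable g x y)
        (fun t ht => hg.pseudoInv_pos (ht.2.trans_le hy.2)) hxy
    have h3 := div_pos h2 hg.integral_pos
    linarith
  zero := hg.T_zero
  one := by
    intro x hx
    rw [T, intervalIntegral.integral_symm, intervalIntegral.integral_of_le hx,
      setIntegral_eq_zero_of_forall_eq_zero (fun t ht => hg.pseudoInv_eq_zero ht.1.le)]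
    simp

lemma pseudoInv_h_zero {y : ℝ} (hy : y ≤ 1) : pseudoInv (h 0) y = 1 := by
  refine le_antisymm (pseudoInv_le_one _ y) ?_
  exact le_csSup (pseudoInv_bddAbove _ y) ⟨⟨zero_le_one, le_rfl⟩, hy⟩

lemma κ_zero : κ 0 = 1 := by simp [κ, h]

lemma h_one_of_le {x : ℝ} (hx : x ≤ 1) : h 1 x = 1 - x := by
  have h1 : ∫ t in x..(1:ℝ), pseudoInv (h 0) t = ∫ t in x..(1:ℝ), (1:ℝ) := by
    refine intervalIntegral.integral_congr fun t ht => ?_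
    rw [uIcc_of_le hx] at ht
    exact pseudoInv_h_zero ht.2
  have h2 : h 1 x = (∫ t in x..(1:ℝ), pseudoInv (h 0) t) / κ 0 := rfl
  rw [h2, h1, κ_zero]; simp

lemma h_one_of_ge {x : ℝ} (hx : 1 ≤ x) : h 1 x = 0 := by
  have h2 : h 1 x = (∫ t in x..(1:ℝ), pseudoInv (h 0) t) / κ 0 := rfl
  rw [h2, intervalIntegral.integral_symm, intervalIntegral.integral_of_le hx,
    setIntegral_eq_zero_of_forall_eq_zero]
  · simp
  · intro t ht
    have : {x | x ∈ Icc (0:ℝ) 1 ∧ t ≤ h 0 x} = ∅ := by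
      ext z; simp only [mem_ofPred_eq, mem_empty_iff_false, iff_false, not_and, not_le]
      intro _; exact ht.1
    rw [pseudoInv, this, Real.sSup_empty]

lemma good_h_one : Good (h 1) where
  cont := by
    have : h 1 = fun x => max (1 - x) 0 := by
      ext x
      rcases le_total x 1 with hx | hx
      · rw [h_one_of_le hx, max_eq_left (by linarith)]
      · rw [h_one_of_ge hx, max_eq_right (by linarith)]
    rw [this]; fun_prop
  anti := by
    intro x hx y hy hxy
    rw [h_one_of_le hx.2, h_one_of_le hy.2]; linarith
  zero := by rw [h_one_of_le zero_le_one]; ring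
  one := fun x hx => h_one_of_ge hx

lemma good_h (n : ℕ) : Good (h (n + 1)) := by
  induction n with
  | zero => exact good_h_one
  | succ n ih => exact ih.map_T

lemma κ_pos (n : ℕ) : 0 < κ n := by
  cases n with
  | zero => rw [κ_zero]; exact one_pos
  | succ n => exact (good_h n).integral_pos

lemma κ_one : κ 1 = 1 / 2 := by
  have : κ 1 = ∫ t in (0:ℝ)..1, (1 - t) := by
    refine intervalIntegral.integral_congr fun t ht => ?_
    rw [uIcc_of_le zero_le_one] at ht
    exact h_one_of_le ht.2
  rw [this, intervalIntegral.integral_comp_sub_left (fun t : ℝ => t) 1]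
  norm_num

lemma pseudoInv_h_one {y : ℝ} (h0 : 0 ≤ y) (h1 : y ≤ 1) : pseudoInv (h 1) y = 1 - y := by
  refine le_antisymm (Real.sSup_le (fun x hx => ?_) (by linarith)) ?_
  · have := hx.2
    rw [h_one_of_le hx.1.2] at this
    linarith
  · refine le_csSup (pseudoInv_bddAbove _ y) ⟨⟨by linarith, by linarith⟩, ?_⟩
    rw [h_one_of_le (by linarith)]; linarith

lemma h_two {x : ℝ} (h0 : 0 ≤ x) (h1 : x ≤ 1) : h 2 x = (1 - x) ^ 2 := by
  have e1 : ∫ t in x..(1:ℝ), pseudoInv (h 1) t = ∫ t in x..(1:ℝ), (1 - t) := by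
    refine intervalIntegral.integral_congr fun t ht => ?_
    rw [uIcc_of_le h1] at ht
    exact pseudoInv_h_one (h0.trans ht.1) ht.2
  have e2 : h 2 x = (∫ t in x..(1:ℝ), pseudoInv (h 1) t) / κ 1 := rfl
  rw [e2, e1, κ_one, intervalIntegral.integral_sub (by simp) (by simp)]
  simp; ring

lemma κ_two : κ 2 = 1 / 3 := by
  have : κ 2 = ∫ t in (0:ℝ)..1, (1 - t) ^ 2 := by
    refine intervalIntegral.integral_congr fun t ht => ?_
    rw [uIcc_of_le zero_le_one] at ht
    exact h_two ht.1 ht.2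
  rw [this, intervalIntegral.integral_comp_sub_left (fun t : ℝ => t ^ 2) 1]
  norm_num

lemma T_scaled_increment (g₁ g₂ : ℝ → ℝ) {α β : ℝ} (hβ : β ≠ 0)
    (hg₁ : ∫ t in (0:ℝ)..1, g₁ t ≠ 0) (x y : ℝ) :
    (α * T g₂ (β * y) - T g₁ y) - (α * T g₂ (β * x) - T g₁ x) =
      (∫ t in x..y, (pseudoInv g₁ t - α * β * (∫ t in (0:ℝ)..1, g₁ t) /
        (∫ t in (0:ℝ)..1, g₂ t) * pseudoInv g₂ (β * t))) / ∫ t in (0:ℝ)..1, g₁ t := by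
  have hi : IntervalIntegrable (fun t => pseudoInv g₂ (β * t)) volume x y := by
    have := (pseudoInv_intervalIntegrable g₂ (β * x) (β * y)).comp_mul_left (c := β)
    rwa [mul_div_cancel_left₀ _ hβ, mul_div_cancel_left₀ _ hβ] at this
  rw [intervalIntegral.integral_sub (pseudoInv_intervalIntegrable g₁ x y) (hi.const_mul _),
    intervalIntegral.integral_const_mul,
    intervalIntegral.integral_comp_mul_left (fun t => pseudoInv g₂ t) hβ, smul_eq_mul]
  have e1 := T_sub g₁ x y
  have e2 := T_sub g₂ (β * x) (β * y)
  have e3 : (α * T g₂ (β * y) - T g₁ y) - (α * T g₂ (β * x) - T g₁ x) =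
    α * (T g₂ (β * y) - T g₂ (β * x)) - (T g₁ y - T g₁ x) := by ring
  rw [e3, e1, e2]
  field_simp
  ring

lemma T_scaled_le {g₁ g₂ : ℝ → ℝ} {α β x y : ℝ} (hβ : β ≠ 0)
    (hg₁ : 0 < ∫ t in (0:ℝ)..1, g₁ t) (hxy : x ≤ y)
    (H : ∀ t ∈ Ioo x y, pseudoInv g₁ t ≤ α * β * (∫ t in (0:ℝ)..1, g₁ t) /
        (∫ t in (0:ℝ)..1, g₂ t) * pseudoInv g₂ (β * t)) :
    α * T g₂ (β * y) - T g₁ y ≤ α * T g₂ (β * x) - T g₁ x := by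
  rw [← sub_nonpos, T_scaled_increment g₁ g₂ hβ hg₁.ne']
  refine div_nonpos_of_nonpos_of_nonneg ?_ hg₁.le
  rw [intervalIntegral.integral_of_le hxy, integral_Ioc_eq_integral_Ioo]
  exact setIntegral_nonpos measurableSet_Ioo fun t ht => sub_nonpos.2 (H t ht)

lemma le_T_scaled {g₁ g₂ : ℝ → ℝ} {α β x y : ℝ} (hβ : β ≠ 0)
    (hg₁ : 0 < ∫ t in (0:ℝ)..1, g₁ t) (hxy : x ≤ y)
    (H : ∀ t ∈ Ioo x y, α * β * (∫ t in (0:ℝ)..1, g₁ t) /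
        (∫ t in (0:ℝ)..1, g₂ t) * pseudoInv g₂ (β * t) ≤ pseudoInv g₁ t) :
    α * T g₂ (β * x) - T g₁ x ≤ α * T g₂ (β * y) - T g₁ y := by
  rw [← sub_nonneg, T_scaled_increment g₁ g₂ hβ hg₁.ne']
  refine div_nonneg ?_ hg₁.le
  rw [intervalIntegral.integral_of_le hxy, integral_Ioc_eq_integral_Ioo]
  exact setIntegral_nonneg measurableSet_Ioo fun t ht => sub_nonneg.2 (H t ht)

/-- On `(0,1)`, no difference `α * g₂ (β * x) - g₁ x` takes signs `-`, `+`, `-` in this order. -/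
def NoNegPosNeg (g₁ g₂ : ℝ → ℝ) : Prop :=
  ∀ α β x₁ x₂ x₃ : ℝ, 0 < α → 0 < β → 0 < x₁ → x₁ < x₂ → x₂ < x₃ → x₃ < 1 →
    α * g₂ (β * x₁) < g₁ x₁ → g₁ x₂ < α * g₂ (β * x₂) → α * g₂ (β * x₃) < g₁ x₃ → False

/-- Rolle's argument: since `α * T g₂ (β * x) - T g₁ x` is nonnegative at `1`, the signs
`-`, `+`, `-` force its derivative to take signs `+`, `-`, `+`. -/
lemma noNegPosNeg_T {g₁ g₂ : ℝ → ℝ} (hg₁ : 0 < ∫ t in (0:ℝ)..1, g₁ t)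
    (hg₂ : 0 < ∫ t in (0:ℝ)..1, g₂ t) (hT₁ : T g₁ 1 = 0) (hT₂ : ∀ x, 0 ≤ x → 0 ≤ T g₂ x)
    (H : ∀ c β t₁ t₂ t₃ : ℝ, 0 < c → 0 < β → 0 < t₁ → t₁ < t₂ → t₂ < t₃ → t₃ < 1 →
      c * pseudoInv g₂ (β * t₁) < pseudoInv g₁ t₁ → pseudoInv g₁ t₂ < c * pseudoInv g₂ (β * t₂) →
      c * pseudoInv g₂ (β * t₃) < pseudoInv g₁ t₃ → False) :
    NoNegPosNeg (T g₁) (T g₂) := by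
  intro α β x₁ x₂ x₃ hα hβ h0 h12 h23 h1 hx₁ hx₂ hx₃
  have hend : 0 ≤ α * T g₂ (β * 1) - T g₁ 1 := by
    rw [hT₁, sub_zero]; exact mul_nonneg hα.le (hT₂ _ (by linarith))
  obtain ⟨t₁, ht₁, ht₁'⟩ : ∃ t ∈ Ioo x₁ x₂, α * β * (∫ t in (0:ℝ)..1, g₁ t) /
      (∫ t in (0:ℝ)..1, g₂ t) * pseudoInv g₂ (β * t) < pseudoInv g₁ t := by
    by_contra! hc
    linarith [T_scaled_le hβ.ne' hg₁ h12.le hc]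
  obtain ⟨t₂, ht₂, ht₂'⟩ : ∃ t ∈ Ioo x₂ x₃, pseudoInv g₁ t < α * β * (∫ t in (0:ℝ)..1, g₁ t) /
      (∫ t in (0:ℝ)..1, g₂ t) * pseudoInv g₂ (β * t) := by
    by_contra! hc
    linarith [le_T_scaled hβ.ne' hg₁ h23.le hc]
  obtain ⟨t₃, ht₃, ht₃'⟩ : ∃ t ∈ Ioo x₃ 1, α * β * (∫ t in (0:ℝ)..1, g₁ t) /
      (∫ t in (0:ℝ)..1, g₂ t) * pseudoInv g₂ (β * t) < pseudoInv g₁ t := by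
    by_contra! hc
    linarith [T_scaled_le hβ.ne' hg₁ h1.le hc]
  exact H _ β t₁ t₂ t₃ (by positivity) hβ (h0.trans ht₁.1) (ht₁.2.trans ht₂.1)
    (ht₂.2.trans ht₃.1) ht₃.2 ht₁' ht₂' ht₃'

lemma Good.apply_lt_of_pseudoInv_lt {g : ℝ → ℝ} (hg : Good g) {a y : ℝ} (ha : 0 < a) (hy : 0 < y)
    (hlt : pseudoInv g y < a) : g a < y := by
  rcases le_or_gt a 1 with h1 | h1
  · exact (hg.pseudoInv_lt_iff ha h1).1 hlt
  · rwa [hg.one a h1.le]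

lemma Good.lt_apply_of_lt_pseudoInv {g : ℝ → ℝ} (hg : Good g) {a y : ℝ} (ha : 0 ≤ a)
    (hlt : a < pseudoInv g y) : y < g a :=
  (hg.lt_pseudoInv_iff ha (hlt.trans_le (pseudoInv_le_one g y))).1 hlt

lemma NoNegPosNeg.map_T {g₁ g₂ : ℝ → ℝ} (h₁ : Good g₁) (h₂ : Good g₂) (H : NoNegPosNeg g₁ g₂) :
    NoNegPosNeg (T g₁) (T g₂) := by
  refine noNegPosNeg_T h₁.integral_pos h₂.integral_pos (h₁.map_T.one 1 le_rfl)
    (fun x hx => h₂.map_T.nonneg hx) ?_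
  intro c β t₁ t₂ t₃ hc hβ h0 h12 h23 h1 ht₁ ht₂ ht₃
  have p₁ := h₁.pseudoInv_lt_one h0
  have p₃ := h₁.pseudoInv_pos h1
  have e₁ := h₁.apply_pseudoInv h0 (h12.trans (h23.trans h1))
  have e₂ := h₁.apply_pseudoInv (h0.trans h12) (h23.trans h1)
  have e₃ := h₁.apply_pseudoInv (h0.trans (h12.trans h23)) h1
  have l₁ := h₁.pseudoInv_strictAnti h0 h12 (h23.trans h1)
  have l₂ := h₁.pseudoInv_strictAnti (h0.trans h12) h23 h1
  rw [← lt_inv_mul_iff₀ hc] at ht₁ ht₃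
  rw [← inv_mul_lt_iff₀ hc] at ht₂
  refine H β⁻¹ c⁻¹ _ _ _ (inv_pos.2 hβ) (inv_pos.2 hc) p₃ l₂ l₁ p₁ ?_ ?_ ?_
  · rw [e₃, inv_mul_lt_iff₀ hβ]
    exact h₂.apply_lt_of_pseudoInv_lt (mul_pos (inv_pos.2 hc) p₃)
      (mul_pos hβ (h0.trans (h12.trans h23))) ht₃
  · rw [e₂, lt_inv_mul_iff₀ hβ]
    exact h₂.lt_apply_of_lt_pseudoInv
      (mul_nonneg (inv_nonneg.2 hc.le) (pseudoInv_nonneg _ _)) ht₂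
  · rw [e₁, inv_mul_lt_iff₀ hβ]
    exact h₂.apply_lt_of_pseudoInv_lt (mul_pos (inv_pos.2 hc) (p₃.trans (l₂.trans l₁)))
      (mul_pos hβ h0) ht₁

lemma noNegPosNeg_h (n : ℕ) : NoNegPosNeg (h (n + 1)) (h (n + 2)) := by
  induction n with
  | zero =>
    refine noNegPosNeg_T (κ_pos 0) (κ_pos 1) ((good_h 0).one 1 le_rfl)
      (fun x hx => (good_h 1).nonneg hx) ?_
    intro c β t₁ t₂ t₃ hc hβ h0 h12 h23 h1 ht₁ ht₂ _
    rw [pseudoInv_h_zero (by linarith)] at ht₁ ht₂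
    have := mul_le_mul_of_nonneg_left
      (pseudoInv_antitone (h 1) (mul_le_mul_of_nonneg_left h12.le hβ.le)) hc.le
    linarith
  | succ n ih => exact ih.map_T (good_h n) (good_h (n + 1))

lemma NoNegPosNeg.T_le_T_scaled {g₁ g₂ : ℝ → ℝ} (h₁ : Good g₁) (h₂ : Good g₂)
    (H : NoNegPosNeg g₁ g₂) {x : ℝ} (hx : x ∈ Ioo (0:ℝ) 1) :
    T g₁ x ≤ T g₂ ((∫ t in (0:ℝ)..1, g₂ t) / (∫ t in (0:ℝ)..1, g₁ t) * x) := by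
  have k₁ := h₁.integral_pos
  have k₂ := h₂.integral_pos
  set r := (∫ t in (0:ℝ)..1, g₂ t) / (∫ t in (0:ℝ)..1, g₁ t) with hr
  have hr0 : 0 < r := div_pos k₂ k₁
  have hl : 1 * r * (∫ t in (0:ℝ)..1, g₁ t) / (∫ t in (0:ℝ)..1, g₂ t) = 1 := by
    rw [hr]; field_simp
  by_contra! hlt
  obtain ⟨t₁, ht₁, ht₁'⟩ : ∃ t ∈ Ioo 0 x, pseudoInv g₁ t < pseudoInv g₂ (r * t) := by
    by_contra! hc
    have := le_T_scaled (g₁ := g₁) (g₂ := g₂) (α := 1) hr0.ne' k₁ hx.1.le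
      (fun t ht => by rw [hl, one_mul]; exact hc t ht)
    rw [mul_zero, h₁.T_zero, h₂.T_zero] at this
    linarith
  obtain ⟨t₂, ht₂, ht₂'⟩ : ∃ t ∈ Ioo x 1, pseudoInv g₂ (r * t) < pseudoInv g₁ t := by
    by_contra! hc
    have := T_scaled_le (g₁ := g₁) (g₂ := g₂) (α := 1) hr0.ne' k₁ hx.2.le
      (fun t ht => by rw [hl, one_mul]; exact hc t ht)
    have h3 := h₂.map_T.nonneg (x := r * 1) (by linarith)
    rw [h₁.map_T.one 1 le_rfl] at this
    linarith
  have l := h₁.pseudoInv_strictAnti ht₁.1 (ht₁.2.trans ht₂.1) ht₂.2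
  have e₁ := h₁.apply_pseudoInv ht₁.1 (ht₁.2.trans hx.2)
  have e₂ := h₁.apply_pseudoInv (hx.1.trans ht₂.1) ht₂.2
  have p₁ := h₁.pseudoInv_lt_one ht₁.1
  have p₂ := h₁.pseudoInv_pos ht₂.2
  set y₁ := pseudoInv g₁ t₁
  set y₂ := pseudoInv g₁ t₂
  have q₁ : r * t₁ < g₂ y₁ := h₂.lt_apply_of_lt_pseudoInv (pseudoInv_nonneg _ _) ht₁'
  have q₂ : g₂ y₂ < r * t₂ :=
    h₂.apply_lt_of_pseudoInv_lt p₂ (mul_pos hr0 (hx.1.trans ht₂.1)) ht₂'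
  -- rescaling by `c > 1` makes the difference negative near `1`
  obtain ⟨c, hc, hc1⟩ : ∃ c, r * t₁ < g₂ (c * y₁) ∧ 1 < c := by
    have hcont : Continuous fun c : ℝ => g₂ (c * y₁) := h₂.cont.comp (by fun_prop)
    have hev : ∀ᶠ c in nhdsWithin 1 (Ioi (1:ℝ)), r * t₁ < g₂ (c * y₁) := by
      refine (hcont.continuousAt.eventually (lt_mem_nhds ?_)).filter_mono nhdsWithin_le_nhds
      simpa using q₁
    exact (hev.and self_mem_nhdsWithin).exists
  have hcy : c * y₁ < 1 := by
    by_contra! hge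
    rw [h₂.one _ hge] at hc
    linarith [mul_pos hr0 ht₁.1]
  have hc0 : 0 < c := by linarith
  have hy₁ : y₁ < c⁻¹ := by rwa [← one_div, lt_div_iff₀' hc0]
  have hci : c⁻¹ < 1 := inv_lt_one_of_one_lt₀ hc1
  refine H r⁻¹ c y₂ y₁ ((c⁻¹ + 1) / 2) (inv_pos.2 hr0) hc0 p₂ l (by linarith) (by linarith)
    ?_ ?_ ?_
  · rw [e₂, inv_mul_lt_iff₀ hr0]
    refine lt_of_le_of_lt ?_ q₂
    exact h₂.antitoneOn_Ici p₂.le (mul_nonneg hc0.le p₂.le) (le_mul_of_one_le_left p₂.le hc1.le)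
  · rwa [e₁, lt_inv_mul_iff₀ hr0]
  · rw [h₂.one, mul_zero]
    · exact h₁.pos (by linarith [inv_pos.2 hc0]) (by linarith)
    · have : c * c⁻¹ = 1 := mul_inv_cancel₀ hc0.ne'
      nlinarith

lemma h_le_h_scaled (n : ℕ) {x : ℝ} (hx : x ∈ Ioo (0:ℝ) 1) :
    h (n + 1) x ≤ h (n + 2) (κ (n + 1) / κ n * x) := by
  cases n with
  | zero =>
    have hr : κ 1 / κ 0 ≠ 0 := (div_pos (κ_pos 1) (κ_pos 0)).ne'
    have hl : 1 * (κ 1 / κ 0) * κ 0 / κ 1 = 1 := by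
      have := (κ_pos 0).ne'
      have := (κ_pos 1).ne'
      field_simp
    have key := le_T_scaled (g₁ := h 0) (g₂ := h 1) (α := 1) hr (κ_pos 0) hx.1.le
      (fun t ht => by
        change 1 * (κ 1 / κ 0) * κ 0 / κ 1 * _ ≤ _
        rw [hl, one_mul, pseudoInv_h_zero (ht.2.trans hx.2).le]
        exact pseudoInv_le_one _ _)
    change 1 * h 2 _ - h 1 _ ≤ 1 * h 2 _ - h 1 _ at key
    rw [mul_zero, (good_h 0).zero, (good_h 1).zero] at key
    change h 1 x ≤ h 2 _
    linarith
  | succ n => exact (noNegPosNeg_h n).T_le_T_scaled (good_h n) (good_h (n + 1)) hx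

lemma mul_pseudoInv_h_le (n : ℕ) {y : ℝ} (hy : y ∈ Ioo (0:ℝ) 1) :
    κ (n + 1) / κ n * pseudoInv (h (n + 1)) y ≤ pseudoInv (h (n + 2)) y := by
  have p := (good_h n).pseudoInv_pos hy.2
  have key := h_le_h_scaled n ⟨p, (good_h n).pseudoInv_lt_one hy.1⟩
  rw [(good_h n).apply_pseudoInv hy.1 hy.2] at key
  by_contra! hlt
  have := (good_h (n + 1)).apply_lt_of_pseudoInv_lt
    (mul_pos (div_pos (κ_pos (n + 1)) (κ_pos n)) p) hy.1 hlt
  linarith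

lemma mul_integral_pseudoInv_h_le (n : ℕ) {x : ℝ} (hx : x ∈ Icc (0:ℝ) 1) :
    κ (n + 1) / κ n * (∫ t in x..(1:ℝ), pseudoInv (h (n + 1)) t) ≤
      ∫ t in x..(1:ℝ), pseudoInv (h (n + 2)) t := by
  rw [← intervalIntegral.integral_const_mul]
  exact intervalIntegral.integral_mono_on_of_le_Ioo hx.2
    ((pseudoInv_intervalIntegrable _ _ _).const_mul _) (pseudoInv_intervalIntegrable _ _ _)
    fun t ht => mul_pseudoInv_h_le n ⟨hx.1.trans_lt ht.1, ht.2⟩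

lemma integral_pseudoInv_h (n : ℕ) (x : ℝ) :
    ∫ t in x..(1:ℝ), pseudoInv (h n) t = κ n * h (n + 1) x :=
  (mul_div_cancel₀ _ (κ_pos n).ne').symm

lemma κ_sq_le (n : ℕ) : κ (n + 1) ^ 2 ≤ κ n * κ (n + 2) := by
  have key := mul_integral_pseudoInv_h_le n (x := 0) ⟨le_rfl, zero_le_one⟩
  rw [integral_pseudoInv_h, integral_pseudoInv_h, (good_h (n + 1)).zero, (good_h (n + 2)).zero,
    div_mul_eq_mul_div, div_le_iff₀ (κ_pos n)] at key
  linarith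

lemma κ_sq_mul_h_le (n : ℕ) {x : ℝ} (hx : x ∈ Icc (0:ℝ) 1) :
    κ (n + 1) ^ 2 * h (n + 2) x ≤ κ n * κ (n + 2) * h (n + 3) x := by
  have key := mul_integral_pseudoInv_h_le n hx
  rw [integral_pseudoInv_h, integral_pseudoInv_h,
    div_mul_eq_mul_div, div_le_iff₀ (κ_pos n)] at key
  linarith

lemma κ_succ_sq_le (n : ℕ) : κ (n + 1) ^ 2 ≤ κ n * κ (n + 3) := by
  have key : ∫ x in (0:ℝ)..1, κ (n + 1) ^ 2 * h (n + 2) x ≤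
      ∫ x in (0:ℝ)..1, κ n * κ (n + 2) * h (n + 3) x :=
    intervalIntegral.integral_mono_on zero_le_one
      (((good_h (n + 1)).cont.intervalIntegrable 0 1).const_mul _)
      (((good_h (n + 2)).cont.intervalIntegrable 0 1).const_mul _) fun x hx => κ_sq_mul_h_le n hx
  rw [intervalIntegral.integral_const_mul, intervalIntegral.integral_const_mul] at key
  change _ * κ (n + 2) ≤ _ * κ (n + 3) at key
  refine le_of_mul_le_mul_right ?_ (κ_pos (n + 2))
  linarith

lemma κ_le_one (n : ℕ) : κ n ≤ 1 := by
  cases n with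
  | zero => rw [κ_zero]
  | succ n =>
    have := intervalIntegral.integral_mono_on (μ := volume) zero_le_one
      ((good_h n).cont.intervalIntegrable 0 1) (intervalIntegrable_const (c := (1:ℝ)))
      fun x hx => (good_h n).le_one hx.1
    simpa [κ] using this

lemma κ_succ_le (n : ℕ) : κ (n + 1) ≤ κ n := by
  by_contra! hlt
  set r := κ (n + 1) / κ n with hr
  have hr1 : 1 < r := (one_lt_div (κ_pos n)).2 hlt
  have step : ∀ m, r * κ (n + m) ≤ κ (n + m + 1) := by
    intro m
    induction m with
    | zero => rw [hr, add_zero, div_mul_cancel₀ _ (κ_pos n).ne']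
    | succ m ih =>
      have h1 := κ_sq_le (n + m)
      have h2 := mul_le_mul_of_nonneg_right ih (κ_pos (n + m + 1)).le
      refine le_of_mul_le_mul_left ?_ (κ_pos (n + m))
      change κ (n + m) * (r * κ (n + m + 1)) ≤ κ (n + m) * κ (n + m + 2)
      linarith
  have growth : ∀ m, r ^ m * κ n ≤ κ (n + m) := by
    intro m
    induction m with
    | zero => simp
    | succ m ih =>
      have := mul_le_mul_of_nonneg_left ih (zero_le_one.trans hr1.le)
      calc r ^ (m + 1) * κ n = r * (r ^ m * κ n) := by ring
        _ ≤ _ := this.trans (step m)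
  obtain ⟨m, hm⟩ := pow_unbounded_of_one_lt (κ n)⁻¹ hr1
  rw [inv_lt_iff_one_lt_mul₀ (κ_pos n), mul_comm] at hm
  linarith [growth m, κ_le_one (n + m)]

lemma hasDerivAt_T {g : ℝ → ℝ} {x : ℝ} (hx : ContinuousAt (pseudoInv g) x) :
    HasDerivAt (T g) (-pseudoInv g x / ∫ t in (0:ℝ)..1, g t) x :=
  (intervalIntegral.integral_hasDerivAt_left (pseudoInv_intervalIntegrable g x 1)
    ((pseudoInv_antitone g).measurable.stronglyMeasurable.stronglyMeasurableAtFilter)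
    hx).div_const _

lemma continuousAt_pseudoInv_h (n : ℕ) {x : ℝ} (hx : x < 1) :
    ContinuousAt (pseudoInv (h n)) x := by
  cases n with
  | zero =>
    refine continuousAt_const.congr (f := fun _ => 1) ?_
    filter_upwards [gt_mem_nhds hx] with y hy
    exact (pseudoInv_h_zero hy.le).symm
  | succ n => exact (good_h n).continuous_pseudoInv.continuousAt

lemma pseudoInv_h_eqOn {n : ℕ} (H : EqOn (h (n + 1)) (h (n + 2)) (Icc 0 1)) :
    EqOn (pseudoInv (h n)) (pseudoInv (h (n + 1))) (Ico 0 1) := by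
  have e1 : EqOn (fun x => pseudoInv (h n) x * κ (n + 1)) (fun x => pseudoInv (h (n + 1)) x * κ n)
      (Ioo 0 1) := by
    intro x hx
    have d1 : HasDerivAt (h (n + 1)) (-pseudoInv (h n) x / κ n) x :=
      hasDerivAt_T (continuousAt_pseudoInv_h n hx.2)
    have d2 : HasDerivAt (h (n + 2)) (-pseudoInv (h (n + 1)) x / κ (n + 1)) x :=
      hasDerivAt_T (continuousAt_pseudoInv_h (n + 1) hx.2)
    have hev : h (n + 1) =ᶠ[nhds x] h (n + 2) := by
      filter_upwards [Icc_mem_nhds hx.1 hx.2] with y hy using H hy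
    have := d1.unique (d2.congr_of_eventuallyEq hev)
    rw [div_eq_div_iff (κ_pos n).ne' (κ_pos (n + 1)).ne'] at this
    simp only
    linarith
  have e2 : EqOn (fun x => pseudoInv (h n) x * κ (n + 1)) (fun x => pseudoInv (h (n + 1)) x * κ n)
      (Ico 0 1) := by
    refine e1.of_subset_closure
      (fun x hx => ((continuousAt_pseudoInv_h n hx.2).mul_const _).continuousWithinAt)
      (fun x hx => ((continuousAt_pseudoInv_h (n + 1) hx.2).mul_const _).continuousWithinAt)
      Ioo_subset_Ico_self ?_
    rw [closure_Ioo zero_ne_one]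
    exact Ico_subset_Icc_self
  have hk : κ (n + 1) = κ n := by
    have h0 := e2 (left_mem_Ico.2 zero_lt_one)
    have z1 : pseudoInv (h n) 0 = 1 := by
      cases n with
      | zero => exact pseudoInv_h_zero zero_le_one
      | succ n => exact (good_h n).pseudoInv_zero
    simpa [z1, (good_h n).pseudoInv_zero] using h0
  intro x hx
  have := e2 hx
  simp only [hk] at this
  exact mul_right_cancel₀ (κ_pos n).ne' this

lemma not_eqOn_h (n : ℕ) : ¬ EqOn (h (n + 1)) (h (n + 2)) (Icc 0 1) := by
  induction n with
  | zero =>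
    intro H
    have := H (x := 1 / 2) ⟨by norm_num, by norm_num⟩
    rw [h_one_of_le (by norm_num), h_two (by norm_num) (by norm_num)] at this
    norm_num at this
  | succ n ih =>
    intro H
    have e := pseudoInv_h_eqOn H
    refine ih fun x hx => ?_
    have lt_iff : ∀ y ∈ Ico (0:ℝ) 1, x < 1 → (y < h (n + 1) x ↔ y < h (n + 2) x) := by
      intro y hy hx1
      rw [← (good_h n).lt_pseudoInv_iff hx.1 hx1, ← (good_h (n + 1)).lt_pseudoInv_iff hx.1 hx1,
        e hy]
    rcases hx.2.lt_or_eq with hx1 | rfl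
    · have b1 := (good_h n).le_one hx.1
      have b2 := (good_h (n + 1)).le_one hx.1
      have c1 := (good_h n).nonneg hx.1
      have c2 := (good_h (n + 1)).nonneg hx.1
      rcases lt_trichotomy (h (n + 1) x) (h (n + 2) x) with hlt | heq | hlt
      · exact absurd ((lt_iff _ ⟨c1, hlt.trans_le b2⟩ hx1).2 hlt) (lt_irrefl _)
      · exact heq
      · exact absurd ((lt_iff _ ⟨c2, hlt.trans_le b1⟩ hx1).1 hlt) (lt_irrefl _)
    · rw [(good_h n).one 1 le_rfl, (good_h (n + 1)).one 1 le_rfl]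

lemma κ_succ_lt (n : ℕ) : κ (n + 1) < κ n := by
  refine lt_of_le_of_ne (κ_succ_le n) fun heq => ?_
  cases n with
  | zero => norm_num [κ_zero, κ_one] at heq
  | succ n =>
    have h2 : κ (n + 3) = κ (n + 2) := by
      refine le_antisymm (κ_succ_le (n + 2)) ?_
      have := κ_sq_le (n + 1)
      change κ (n + 2) ^ 2 ≤ κ (n + 1) * κ (n + 3) at this
      rw [← heq, sq] at this
      exact le_of_mul_le_mul_left this (κ_pos (n + 2))
    have hle : ∀ x ∈ Icc (0:ℝ) 1, h (n + 3) x ≤ h (n + 4) x := by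
      intro x hx
      have := κ_sq_mul_h_le (n + 1) hx
      change κ (n + 2) ^ 2 * h (n + 3) x ≤ κ (n + 1) * κ (n + 3) * h (n + 4) x at this
      rw [h2, ← heq, ← sq] at this
      exact le_of_mul_le_mul_left this (pow_pos (κ_pos _) 2)
    have h3 : κ (n + 4) ≤ κ (n + 3) := κ_succ_le (n + 3)
    refine not_eqOn_h (n + 2) fun x hx => ?_
    by_contra hne
    have hlt := lt_of_le_of_ne (hle x hx) hne
    have := intervalIntegral.integral_lt_integral_of_continuousOn_of_le_of_exists_lt (zero_lt_one' ℝ)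
      (good_h (n + 2)).cont.continuousOn (good_h (n + 3)).cont.continuousOn
      (fun y hy => hle y (Ioc_subset_Icc_self hy)) ⟨x, hx, hlt⟩
    exact absurd this (not_lt.2 h3)

lemma κ_antitone : Antitone κ := antitone_nat_of_succ_le κ_succ_le

lemma κ_add_two_sub_le (n : ℕ) : κ (n + 1) - κ (n + 3) ≤ κ n - κ (n + 1) := by
  have h1 := κ_succ_sq_le n
  have h2 := κ_succ_le n
  have h3 := κ_pos n
  refine le_of_mul_le_mul_left ?_ h3
  nlinarith

lemma le_κ_add (n m : ℕ) : κ (n + 1) + κ (n + 2) - κ n ≤ κ m := by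
  have mono : Monotone fun k => κ (k + 1) + κ (k + 2) - κ k := by
    refine monotone_nat_of_le_succ fun k => ?_
    have := κ_add_two_sub_le k
    change κ (k + 1) + κ (k + 2) - κ k ≤ κ (k + 2) + κ (k + 3) - κ (k + 1)
    linarith
  have h1 := mono (le_max_left n m)
  have h2 := κ_succ_le (max n m)
  have h3 : κ (max n m + 2) ≤ κ (max n m + 1) := κ_succ_le (max n m + 1)
  have h4 := κ_antitone (le_max_right n m)
  simp only at h1
  linarith

/-- For every n ≥ 1, κ n − 1 + κ n / κ (n-1) < κ, where κ = inf_n κ n. -/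
theorem stmt7 : ∀ n : ℕ, 1 ≤ n →
    κ n - 1 + κ n / κ (n - 1) < ⨅ m : ℕ, κ m := by
  intro n hn
  obtain ⟨k, rfl⟩ : ∃ k, n = k + 1 := ⟨n - 1, by omega⟩
  rw [Nat.add_sub_cancel]
  cases k with
  | zero =>
    refine lt_of_lt_of_le ?_ (le_ciInf (le_κ_add 1))
    have := κ_sq_le 1
    norm_num [κ_zero, κ_one, κ_two] at this ⊢
    linarith
  | succ k =>
    refine lt_of_lt_of_le ?_ (le_ciInf (le_κ_add (k + 1)))
    have h1 : κ (k + 2) < κ (k + 1) := κ_succ_lt (k + 1)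
    have h2 : κ (k + 2) ^ 2 ≤ κ (k + 1) * κ (k + 3) := κ_sq_le (k + 1)
    have h3 : κ (k + 1) ≤ 1 / 2 := κ_one ▸ κ_antitone (by omega : 1 ≤ k + 1)
    have h4 := κ_pos (k + 1)
    change κ (k + 2) - 1 + κ (k + 2) / κ (k + 1) < κ (k + 2) + κ (k + 3) - κ (k + 1)
    have h5 : κ (k + 2) / κ (k + 1) < 1 + κ (k + 3) - κ (k + 1) := by
      rw [div_lt_iff₀ h4]
      nlinarith
    linarith
end
end
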